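/- Fix β ∈ ℝ^{d(k+1)} and data consisting, for each stratum h = 1,…,H and cluster i = 1,…,n_h, of a covariate x_hi ∈ ℝ^{k+1}, a weight w_hi ∈ ℝ, a size m_hi > 0 and a count vector ŷ_hi ∈ ℝ^{d+1} with nonnegative entries satisfying Σ_{l=1}^{d+1} ŷ_hil = m_hi. For λ > 0 let d*_λ(β) = Σ_{h,i} w_hi Σ_{l=1}^{d+1} [ m_hi π_hil(β)^{λ+1} − ((λ+1)/λ) ŷ_hil π_hil(β)^λ ], where π_hi(β) = π(β, x_hi). Then lim_{λ → 0⁺} [ d*_λ(β) + (1/λ) Σ_{h,i} w_hi m_hi ] = − ℓ(β, w), where ℓ(β, w) = Σ_{h,i} w_hi Σ_{l=1}^{d+1} ŷ_hil · log π_hil(β) is the quasi weighted loglikelihood. Hence the kernel of the quasi weighted DPD recovers (up to a constant not depending on β) the negative quasi weighted loglikelihood as λ → 0, so the minimum quasi weighted DPD estimator at λ = 0 coincides with the maximum quasi weighted likelihood estimator. -/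

import Mathlib

open Filter

noncomputable def plr (d k : ℕ) (β : Fin d → Fin (k + 1) → ℝ) (x : Fin (k + 1) → ℝ) :
    Fin (d + 1) → ℝ := fun r =>
  if h : (r : ℕ) < d then
    Real.exp (∑ u, x u * β ⟨r, h⟩ u) / (1 + ∑ l, Real.exp (∑ u, x u * β l u))
  else 1 / (1 + ∑ l, Real.exp (∑ u, x u * β l u))

theorem plr_pos (d k : ℕ) (β : Fin d → Fin (k + 1) → ℝ) (x : Fin (k + 1) → ℝ)
    (r : Fin (d + 1)) : 0 < plr d k β x r := by
  unfold plr
  split_ifs <;> positivity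

theorem plr_sum (d k : ℕ) (β : Fin d → Fin (k + 1) → ℝ) (x : Fin (k + 1) → ℝ) :
    ∑ r, plr d k β x r = 1 := by
  have hpos : 0 < 1 + ∑ l, Real.exp (∑ u, x u * β l u) := by positivity
  rw [Fin.sum_univ_castSucc]
  simp only [plr, Fin.val_castSucc, Fin.is_lt, dite_true, Fin.val_last, lt_irrefl, dite_false,
    Fin.eta]
  rw [← Finset.sum_div, ← add_div, add_comm]
  exact div_self hpos.ne'

theorem rpow_slope_tendsto (p : ℝ) (hp : 0 < p) :
    Tendsto (fun t : ℝ => (p ^ t - 1) / t) (nhdsWithin 0 (Set.Ioi 0)) (nhds (Real.log p)) := by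
  have h := (Real.hasStrictDerivAt_const_rpow hp 0).hasDerivAt
  rw [hasDerivAt_iff_tendsto_slope] at h
  have h2 := h.mono_left (nhdsWithin_mono (0 : ℝ) (fun t (ht : t ∈ Set.Ioi (0 : ℝ)) =>
    (ne_of_gt ht : t ≠ 0)))
  simp only [Real.rpow_zero, one_mul] at h2
  refine h2.congr (fun t => ?_)
  simp [slope_def_field]

/-- As `λ → 0⁺`, the kernel of the quasi weighted DPD plus the constant
`(1/λ) Σ_{h,i} w_hi m_hi` converges to the negative quasi weighted loglikelihood
`−ℓ(β,w) = −Σ_{h,i} w_hi Σ_l ŷ_hil log π_hil(β)`; hence the minimum quasi weighted DPD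
estimator at `λ = 0` coincides with the maximum quasi weighted likelihood estimator. -/
theorem dpd_tendsto_neg_loglikelihood (d k H : ℕ)
    (β : Fin d → Fin (k + 1) → ℝ) (nh : Fin H → ℕ)
    (x : ∀ h : Fin H, Fin (nh h) → Fin (k + 1) → ℝ)
    (w m : ∀ h : Fin H, Fin (nh h) → ℝ)
    (yhat : ∀ h : Fin H, Fin (nh h) → Fin (d + 1) → ℝ)
    (hm : ∀ h i, 0 < m h i) (hy : ∀ h i l, 0 ≤ yhat h i l)
    (hysum : ∀ h i, ∑ l, yhat h i l = m h i) :
    Tendsto (fun lam : ℝ =>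
        (∑ h, ∑ i, w h i *
          ∑ l, (m h i * plr d k β (x h i) l ^ (lam + 1)
            - ((lam + 1) / lam) * yhat h i l * plr d k β (x h i) l ^ lam))
        + (1 / lam) * ∑ h, ∑ i, w h i * m h i)
      (nhdsWithin 0 (Set.Ioi 0))
      (nhds (-(∑ h, ∑ i, w h i *
        ∑ l, yhat h i l * Real.log (plr d k β (x h i) l)))) := by
  have hS : Tendsto (fun lam : ℝ => ∑ h, ∑ i, w h i *
      ∑ l, (m h i * plr d k β (x h i) l ^ (lam + 1)
        - yhat h i l * ((plr d k β (x h i) l ^ lam - 1) / lam)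
        - yhat h i l * plr d k β (x h i) l ^ lam))
      (nhdsWithin 0 (Set.Ioi 0))
      (nhds (∑ h, ∑ i, w h i *
        ∑ l, (m h i * plr d k β (x h i) l - yhat h i l * Real.log (plr d k β (x h i) l)
          - yhat h i l))) := by
    refine tendsto_finsetSum _ fun h _ => tendsto_finsetSum _ fun i _ =>
      Tendsto.const_mul _ (tendsto_finsetSum _ fun l _ => ?_)
    have hp := plr_pos d k β (x h i) l
    have hc : Tendsto (fun t : ℝ => plr d k β (x h i) l ^ t)
        (nhdsWithin 0 (Set.Ioi 0)) (nhds 1) := by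
      have := (Real.continuous_const_rpow hp.ne').tendsto 0
      rw [Real.rpow_zero] at this
      exact this.mono_left nhdsWithin_le_nhds
    refine Tendsto.sub (Tendsto.sub ?_ ((rpow_slope_tendsto _ hp).const_mul _)) ?_
    · have := (hc.mul_const (plr d k β (x h i) l)).const_mul (m h i)
      rw [one_mul] at this
      refine this.congr fun t => ?_
      rw [Real.rpow_add_one hp.ne']
    · simpa using hc.const_mul (yhat h i l)
  have hlim : (∑ h, ∑ i, w h i *
        ∑ l, (m h i * plr d k β (x h i) l - yhat h i l * Real.log (plr d k β (x h i) l)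
          - yhat h i l)) = -(∑ h, ∑ i, w h i *
        ∑ l, yhat h i l * Real.log (plr d k β (x h i) l)) := by
    simp only [← Finset.sum_neg_distrib]
    refine Finset.sum_congr rfl fun h _ => Finset.sum_congr rfl fun i _ => ?_
    rw [Finset.sum_sub_distrib, Finset.sum_sub_distrib, ← Finset.mul_sum, plr_sum, hysum]
    ring
  rw [hlim] at hS
  refine hS.congr' ?_
  filter_upwards [self_mem_nhdsWithin] with t ht
  have ht0 : t ≠ 0 := ne_of_gt ht
  rw [Finset.mul_sum, ← Finset.sum_add_distrib]
  refine Finset.sum_congr rfl fun h _ => ?_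
  rw [Finset.mul_sum, ← Finset.sum_add_distrib]
  refine Finset.sum_congr rfl fun i _ => ?_
  rw [← hysum h i, mul_left_comm, ← mul_add]
  congr 1
  rw [Finset.mul_sum, ← Finset.sum_add_distrib]
  refine Finset.sum_congr rfl fun l _ => ?_
  field_simp
  ring
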